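/- arXiv:1411.7395 — 3 statements merged into one kernel-verified Lean document; each statement's English description precedes it below -/
import Mathlib

section
/- Let F be an infinite field of characteristic p > 0, let A be a (possibly non-unital) associative F-algebra, and let A₁, A₂ be subalgebras of A with A = A₁ + A₂. Suppose A₁ satisfies the symmetric identity of degree d₁ and A₂ satisfies the symmetric identity of degree d₂. Assume there exist an integer k > 0, an index i ∈ {1,2}, and F-vector subspaces V₁ ⊆ A₁ and V₂ ⊆ A₂ with V_j of finite codimension t_j in A_j (j = 1,2), such that every product of the form v₁w₁v₂w₂⋯v_k w_k with v₁,…,v_k ∈ V₁ and w₁,…,w_k ∈ V₂ lies in A_i. Then A satisfies the symmetric identity of degree D = ((d₁ + d₂ − 2)(k·d_i + 2) − 1)·((t₁ + t₂)(p − 1) + 1) + 1. -/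
/-- The ordered product `a (σ 1) * ⋯ * a (σ D)`, computed in the unitization `A¹ = Unitization F A`
of the (possibly non-unital) algebra `A`. -/
noncomputable def permProd (F : Type*) {A : Type*} [Field F] [NonUnitalRing A]
    [Module F A] [SMulCommClass F A A] [IsScalarTower F A A]
    {D : ℕ} (a : Fin D → A) (σ : Equiv.Perm (Fin D)) : Unitization F A :=
  (List.ofFn fun i => (Unitization.inr (a (σ i)) : Unitization F A)).prod

/-- The symmetric sum `∑_{σ ∈ S_D} a_{σ(1)} ⋯ a_{σ(D)}` (computed in the unitization, where it
vanishes iff it vanishes in `A`, since `A` embeds in `Unitization F A`). -/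
noncomputable def symSum (F : Type*) {A : Type*} [Field F] [NonUnitalRing A]
    [Module F A] [SMulCommClass F A A] [IsScalarTower F A A]
    {D : ℕ} (a : Fin D → A) : Unitization F A :=
  ∑ σ : Equiv.Perm (Fin D), permProd F a σ

/-- `A` satisfies the symmetric identity of degree `d`. -/
def SatisfiesSymId (F : Type*) (A : Type*) [Field F] [NonUnitalRing A]
    [Module F A] [SMulCommClass F A A] [IsScalarTower F A A] (d : ℕ) : Prop :=
  ∀ a : Fin d → A, symSum F a = 0

/-- The subset `S` of `A` (e.g. a subalgebra) satisfies the symmetric identity of degree `d`. -/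
def SatisfiesSymIdOn (F : Type*) {A : Type*} [Field F] [NonUnitalRing A]
    [Module F A] [SMulCommClass F A A] [IsScalarTower F A A]
    (S : Set A) (d : ℕ) : Prop :=
  ∀ a : Fin d → A, (∀ i, a i ∈ S) → symSum F a = 0

open TensorProduct

/-- If finitely many generators of an ideal have vanishing `p`-th power, the ideal is nilpotent. -/
theorem ideal_span_range_pow_eq_zero {R ι : Type*} [CommRing R] [Fintype ι] {p : ℕ} (hp : 0 < p)
    (c : ι → R) (hc : ∀ j, c j ^ p = 0) :
    Ideal.span (Set.range c) ^ (Fintype.card ι * (p - 1) + 1) = 0 := by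
  classical
  have key : ∀ s : Finset ι, (∑ j ∈ s, Ideal.span {c j}) ^ (s.card * (p - 1) + 1) = 0 := by
    intro s
    induction s using Finset.induction_on with
    | empty => simp
    | insert a s ha ih =>
      rw [Finset.sum_insert ha, Finset.card_insert_of_notMem ha]
      have h1 : Ideal.span {c a} ^ p = 0 := by
        rw [Ideal.span_singleton_pow, hc]; simp
      refine (Commute.all _ _).add_pow_eq_zero_of_add_le_succ_of_pow_eq_zero h1 ih ?_
      rw [add_mul, one_mul]
      omega
  have := key Finset.univ
  rwa [Ideal.sum_eq_sup, Finset.sup_univ_eq_iSup, ← Ideal.span_iUnion,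
    Set.iUnion_singleton_eq_range, Finset.card_univ] at this

/-- Powers of a combination of `u i` with commuting square-zero coefficients `c i` only involve
the words without repeated letters. -/
theorem sum_smul_pow_eq_sum_injective {R B ι : Type*} [CommRing R] [Ring B] [Algebra R B]
    [Fintype ι] [DecidableEq ι] (d : ℕ) (c : ι → R) (hc : ∀ j, c j ^ 2 = 0) (u : ι → B) :
    (∑ j, c j • u j) ^ d = ∑ r : Fin d → ι with Function.Injective r,
      (∏ i, c (r i)) • (List.ofFn fun i => u (r i)).prod := by
  classical
  have h := (MultilinearMap.mkPiAlgebraFin R d B).map_sum (fun _ j => c j • u j)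
  rw [MultilinearMap.mkPiAlgebraFin_apply_const] at h
  rw [h, Finset.sum_filter]
  refine Finset.sum_congr rfl fun r _ => ?_
  rw [MultilinearMap.map_smul_univ, MultilinearMap.mkPiAlgebraFin_apply]
  split_ifs with hr
  · rfl
  · obtain ⟨a, b, hab, hne⟩ : ∃ a b, r a = r b ∧ a ≠ b := by
      simpa [Function.Injective] using hr
    have : ∏ i, c (r i) = 0 := by
      rw [← Finset.mul_prod_erase _ _ (Finset.mem_univ a),
        ← Finset.mul_prod_erase _ _ (Finset.mem_erase.2 ⟨hne.symm, Finset.mem_univ b⟩),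
        ← mul_assoc, hab, ← pow_two, hc, zero_mul]
    rw [this, zero_smul]

/-- A sum over injective maps vanishes if it vanishes on each orbit of the permutations of the
source. -/
theorem sum_injective_eq_zero {ι M : Type*} [Fintype ι] [DecidableEq ι] [AddCommMonoid M] {d : ℕ}
    (g : (Fin d → ι) → M)
    (hg : ∀ r, Function.Injective r → ∑ σ : Equiv.Perm (Fin d), g (r ∘ σ) = 0) :
    ∑ r : Fin d → ι with Function.Injective r, g r = 0 := by
  classical
  rw [← Finset.sum_fiberwise _ (fun r => Set.range r)]
  refine Finset.sum_eq_zero fun b _ => ?_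
  by_cases hb : ∃ r : Fin d → ι, Function.Injective r ∧ Set.range r = b
  · obtain ⟨r₀, hr₀, rfl⟩ := hb
    rw [← hg r₀ hr₀]
    symm
    refine Finset.sum_bij (fun σ _ => r₀ ∘ σ) ?_ ?_ ?_ fun _ _ => rfl
    · intro σ _
      simp [hr₀.comp σ.injective, Set.range_comp]
    · intro σ _ τ _ h
      ext1 j
      exact hr₀ (congrFun h j)
    · intro r hr
      obtain ⟨hr, hrange⟩ := by simpa using hr
      refine ⟨(Equiv.ofInjective r hr).trans
        ((Equiv.setCongr hrange).trans (Equiv.ofInjective r₀ hr₀).symm), Finset.mem_univ _, ?_⟩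
      ext j
      simpa using Equiv.apply_ofInjective_symm hr₀ ⟨r j, hrange ▸ Set.mem_range_self j⟩
  · push Not at hb
    refine Finset.sum_eq_zero fun r hr => ?_
    simp only [Finset.mem_filter, Finset.mem_univ, true_and] at hr
    exact (hb r hr.1 hr.2).elim

theorem prod_ofFn_one_tmul {F R U : Type*} [Field F] [CommRing R] [Algebra F R] [Ring U]
    [Algebra F U] {d : ℕ} (a : Fin d → U) :
    (List.ofFn fun i => (1 : R) ⊗ₜ[F] a i).prod = (1 : R) ⊗ₜ[F] (List.ofFn a).prod := by
  have := map_list_prod (Algebra.TensorProduct.includeRight : U →ₐ[F] R ⊗[F] U) (List.ofFn a)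
  rw [List.map_ofFn] at this
  exact this.symm

section SquareZeroSpan

variable {F : Type*} (R : Type*) {U : Type*} [Field F] [CommRing R] [Algebra F R] [Ring U]
  [Algebra F U]

/-- The span in `R ⊗ U` of the pure tensors `c ⊗ s` with `c ^ 2 = 0` and `s ∈ S`. -/
def squareZeroSpan (S : Submodule F U) : Submodule F (R ⊗[F] U) :=
  Submodule.span F {z | ∃ c : R, ∃ s ∈ S, c ^ 2 = 0 ∧ z = c ⊗ₜ[F] s}

variable {R}

theorem tmul_mem_squareZeroSpan {S : Submodule F U} {c : R} {s : U} (hc : c ^ 2 = 0)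
    (hs : s ∈ S) : c ⊗ₜ[F] s ∈ squareZeroSpan R S :=
  Submodule.subset_span ⟨c, s, hs, hc, rfl⟩

theorem squareZeroSpan_mono {S T : Submodule F U} (h : S ≤ T) :
    squareZeroSpan R S ≤ squareZeroSpan R T :=
  Submodule.span_mono fun _ ⟨c, s, hs, hc, hz⟩ => ⟨c, s, h hs, hc, hz⟩

theorem mul_mem_squareZeroSpan {S T : Submodule F U} {x y : R ⊗[F] U}
    (hx : x ∈ squareZeroSpan R S) (hy : y ∈ squareZeroSpan R T) :
    x * y ∈ squareZeroSpan R (S * T) := by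
  have : squareZeroSpan R S * squareZeroSpan R T ≤ squareZeroSpan R (S * T) := by
    rw [squareZeroSpan, squareZeroSpan, Submodule.span_mul_span, Submodule.span_le]
    rintro _ ⟨_, ⟨c, s, hs, hc, rfl⟩, _, ⟨c', s', hs', hc', rfl⟩, rfl⟩
    simp only [Algebra.TensorProduct.tmul_mul_tmul]
    exact tmul_mem_squareZeroSpan (by rw [mul_pow, hc, zero_mul]) (Submodule.mul_mem_mul hs hs')
  exact this (Submodule.mul_mem_mul hx hy)

theorem pow_mem_squareZeroSpan {S : Submodule F U} {x : R ⊗[F] U}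
    (hx : x ∈ squareZeroSpan R S) (n : ℕ) :
    x ^ (n + 1) ∈ squareZeroSpan R (S ^ (n + 1)) := by
  induction n with
  | zero => simpa using hx
  | succ n ih =>
    rw [pow_succ x, pow_succ S]
    exact mul_mem_squareZeroSpan ih hx

/-- The symmetric identity of degree `d` on `S` makes `squareZeroSpan R S` nil of index `d`. -/
theorem pow_eq_zero_of_mem_squareZeroSpan {S : Submodule F U} {d : ℕ}
    (hS : ∀ a : Fin d → U, (∀ i, a i ∈ S) →
      ∑ σ : Equiv.Perm (Fin d), (List.ofFn fun i => a (σ i)).prod = 0)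
    {x : R ⊗[F] U} (hx : x ∈ squareZeroSpan R S) : x ^ d = 0 := by
  classical
  obtain ⟨n, f, g, rfl⟩ := Submodule.mem_span_set'.1 hx
  choose c s hs hc hz using fun i => (g i).2
  have hsum : ∑ i, f i • (g i : R ⊗[F] U)
      = ∑ i, (f i • c i) • ((1 : R) ⊗ₜ[F] s i) := by
    refine Finset.sum_congr rfl fun i _ => ?_
    rw [hz, TensorProduct.smul_tmul', TensorProduct.smul_tmul', smul_eq_mul, mul_one]
  rw [hsum, sum_smul_pow_eq_sum_injective d _ (fun j => by rw [smul_pow, hc, smul_zero])]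
  refine sum_injective_eq_zero _ fun r _ => ?_
  have hprod : ∀ σ : Equiv.Perm (Fin d),
      ∏ i, f (r (σ i)) • c (r (σ i)) = ∏ i, f (r i) • c (r i) :=
    fun σ => Equiv.prod_comp σ fun i => f (r i) • c (r i)
  simp only [Function.comp_apply, hprod]
  rw [← Finset.smul_sum]
  have := hS (fun i => s (r i)) (fun i => hs _)
  simp only [prod_ofFn_one_tmul, ← TensorProduct.tmul_sum]
  rw [this, TensorProduct.tmul_zero, smul_zero]

/-- In characteristic `p`, square-zero elements span a space of elements with `p`-th power `0`. -/
theorem pow_char_eq_zero_of_mem_span {p : ℕ} (hp : p.Prime) [CharP F p] {c : R}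
    (hc : c ∈ Submodule.span F {c : R | c ^ 2 = 0}) : c ^ p = 0 := by
  have hpR : (p : R) = 0 := by
    rw [← map_natCast (algebraMap F R), CharP.cast_eq_zero, map_zero]
  induction hc using Submodule.span_induction with
  | mem x hx => exact pow_eq_zero_of_le hp.two_le hx
  | zero => exact zero_pow hp.ne_zero
  | add x y _ _ hx hy =>
    obtain ⟨r, hr⟩ := exists_add_pow_prime_eq hp x y
    rw [hr, hx, hy, hpR]
    ring
  | smul a x _ hx => rw [smul_pow, hx, smul_zero]

/-- Elements of `squareZeroSpan R S` decompose along a finite-codimensional subspace `V` of `S`. -/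
theorem exists_decomposition_of_mem_squareZeroSpan {S V : Submodule F U} {t : ℕ} {e : Fin t → U}
    (he : ∀ s ∈ S, ∃ φ : Fin t → F, s - ∑ j, φ j • e j ∈ V)
    {x : R ⊗[F] U} (hx : x ∈ squareZeroSpan R S) :
    ∃ v ∈ squareZeroSpan R V, ∃ c : Fin t → R,
      (∀ j, c j ∈ Submodule.span F {c : R | c ^ 2 = 0}) ∧
      x = v + ∑ j, c j • ((1 : R) ⊗ₜ[F] e j) := by
  induction hx using Submodule.span_induction with
  | mem x hx =>
    obtain ⟨c, s, hs, hc, rfl⟩ := hx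
    obtain ⟨φ, hφ⟩ := he s hs
    refine ⟨_, tmul_mem_squareZeroSpan hc hφ, fun j => φ j • c,
      fun j => Submodule.smul_mem _ _ (Submodule.subset_span hc), ?_⟩
    simp only [TensorProduct.tmul_sub, TensorProduct.tmul_sum, TensorProduct.smul_tmul',
      TensorProduct.tmul_smul, smul_eq_mul, mul_one, sub_add_cancel]
  | zero => exact ⟨0, zero_mem _, 0, fun _ => zero_mem _, by simp⟩
  | add x y _ _ hx hy =>
    obtain ⟨v, hv, c, hc, rfl⟩ := hx
    obtain ⟨v', hv', c', hc', rfl⟩ := hy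
    refine ⟨v + v', add_mem hv hv', c + c', fun j => add_mem (hc j) (hc' j), ?_⟩
    simp only [Pi.add_apply, add_smul, Finset.sum_add_distrib]
    abel
  | smul a x _ hx =>
    obtain ⟨v, hv, c, hc, rfl⟩ := hx
    refine ⟨a • v, Submodule.smul_mem _ _ hv, a • c, fun j => Submodule.smul_mem _ _ (hc j), ?_⟩
    simp only [Pi.smul_apply, smul_assoc, smul_add, Finset.smul_sum]

end SquareZeroSpan

theorem mul_mem_ideal_smul_top {R B : Type*} [CommRing R] [Ring B] [Algebra R B] {I J : Ideal R}
    {x y : B} (hx : x ∈ I • (⊤ : Submodule R B)) (hy : y ∈ J • (⊤ : Submodule R B)) :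
    x * y ∈ (I * J) • (⊤ : Submodule R B) := by
  induction hx using Submodule.smul_induction_on' with
  | smul r hr n _ =>
    induction hy using Submodule.smul_induction_on' with
    | smul r' hr' n' _ =>
      rw [smul_mul_smul_comm]
      exact Submodule.smul_mem_smul (Ideal.mul_mem_mul hr hr') trivial
    | add y _ y' _ h h' => rw [mul_add]; exact add_mem h h'
  | add x _ x' _ h h' => rw [add_mul]; exact add_mem h h'

theorem pow_mem_ideal_smul_top {R B : Type*} [CommRing R] [Ring B] [Algebra R B] {I : Ideal R}
    {x : B} (hx : x ∈ I • (⊤ : Submodule R B)) (n : ℕ) :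
    x ^ n ∈ (I ^ n) • (⊤ : Submodule R B) := by
  induction n with
  | zero => simp
  | succ n ih =>
    rw [pow_succ, pow_succ]
    exact mul_mem_ideal_smul_top ih hx

/-- Powers of elements congruent modulo `I • ⊤` are congruent modulo `I • ⊤`. -/
theorem pow_sub_pow_mem_ideal_smul_top {R B : Type*} [CommRing R] [Ring B] [Algebra R B]
    {I : Ideal R} {x y : B} (h : x - y ∈ I • (⊤ : Submodule R B)) (n : ℕ) :
    x ^ n - y ^ n ∈ I • (⊤ : Submodule R B) := by
  have hl : ∀ b z : B, z ∈ I • (⊤ : Submodule R B) → b * z ∈ I • (⊤ : Submodule R B) :=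
    fun b z hz => by
      simpa using mul_mem_ideal_smul_top (I := ⊤) (x := b) (by simp) hz
  have hr : ∀ b z : B, z ∈ I • (⊤ : Submodule R B) → z * b ∈ I • (⊤ : Submodule R B) :=
    fun b z hz => by
      simpa using mul_mem_ideal_smul_top (J := ⊤) (y := b) hz (by simp)
  induction n with
  | zero => simp
  | succ n ih =>
    have : x ^ (n + 1) - y ^ (n + 1) = (x ^ n - y ^ n) * x + y ^ n * (x - y) := by
      rw [pow_succ, pow_succ]; noncomm_ring
    rw [this]
    exact add_mem (hr _ _ ih) (hl _ _ h)

/-- Geometric series: `1 - x₁ - x₂` is invertible when `x₁`, `x₂` are nilpotent and the product of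
`∑_{r ≥ 1} x₁ ^ r` and `∑_{r ≥ 1} x₂ ^ r` is nilpotent. -/
theorem one_sub_add_mul_eq_one {B : Type*} [Ring B] {x₁ x₂ P Q h : B}
    (hP : (1 + P) * (1 - x₁) = 1) (hP' : (1 - x₁) * (1 + P) = 1) (hQ : (1 - x₂) * (1 + Q) = 1)
    (hh : (1 - P * Q) * h = 1) :
    (1 - (x₁ + x₂)) * ((1 + Q) * h * (1 + P)) = 1 := by
  have hx₂ : x₂ * (1 + Q) = Q := by
    have : x₂ * (1 + Q) = (1 + Q) - (1 - x₂) * (1 + Q) := by noncomm_ring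
    rw [this, hQ]; abel
  have key : (1 + P) * ((1 - (x₁ + x₂)) * (1 + Q)) = 1 - P * Q := by
    have : (1 + P) * ((1 - (x₁ + x₂)) * (1 + Q))
        = (1 + P) * (1 - x₁) * (1 + Q) - (1 + P) * (x₂ * (1 + Q)) := by noncomm_ring
    rw [this, hP, hx₂]; noncomm_ring
  have key' : (1 - (x₁ + x₂)) * (1 + Q) = (1 - x₁) * (1 - P * Q) := by
    rw [← key, ← mul_assoc (1 - x₁), hP', one_mul]
  rw [← mul_assoc, ← mul_assoc, key', mul_assoc (1 - x₁), hh, mul_one, hP']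

theorem pow_mul_eq_zero_of_mem_squareZeroSpan {F R U : Type*} [Field F] [CommRing R] [Algebra F R]
    [Ring U] [Algebra F U] {p : ℕ} (hp : p.Prime) [CharP F p]
    {S₁ S₂ V₁ V₂ W : Submodule F U} {t₁ t₂ k d : ℕ} {e₁ : Fin t₁ → U} {e₂ : Fin t₂ → U}
    (he₁ : ∀ s ∈ S₁, ∃ φ : Fin t₁ → F, s - ∑ j, φ j • e₁ j ∈ V₁)
    (he₂ : ∀ s ∈ S₂, ∃ φ : Fin t₂ → F, s - ∑ j, φ j • e₂ j ∈ V₂)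
    (hk : 0 < k) (hVW : (V₁ * V₂) ^ k ≤ W)
    (hW : ∀ a : Fin d → U, (∀ i, a i ∈ W) →
      ∑ σ : Equiv.Perm (Fin d), (List.ofFn fun i => a (σ i)).prod = 0)
    {P Q : R ⊗[F] U} (hP : P ∈ squareZeroSpan R S₁) (hQ : Q ∈ squareZeroSpan R S₂) :
    (P * Q) ^ (k * d * ((t₁ + t₂) * (p - 1) + 1)) = 0 := by
  obtain ⟨v, hv, c, hc, rfl⟩ := exists_decomposition_of_mem_squareZeroSpan he₁ hP
  obtain ⟨w, hw, c', hc', rfl⟩ := exists_decomposition_of_mem_squareZeroSpan he₂ hQ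
  set I : Ideal R := Ideal.span (Set.range (Sum.elim c c')) with hI
  have hIpow : I ^ ((t₁ + t₂) * (p - 1) + 1) = 0 := by
    have := ideal_span_range_pow_eq_zero hp.pos (Sum.elim c c') (by
      rintro (j | j)
      · exact pow_char_eq_zero_of_mem_span hp (hc j)
      · exact pow_char_eq_zero_of_mem_span hp (hc' j))
    rwa [Fintype.card_sum, Fintype.card_fin, Fintype.card_fin] at this
  have hvw : (v * w) ^ (k * d) = 0 := by
    rw [pow_mul]
    refine pow_eq_zero_of_mem_squareZeroSpan hW (squareZeroSpan_mono hVW ?_)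
    obtain ⟨m, rfl⟩ := Nat.exists_eq_succ_of_ne_zero hk.ne'
    exact pow_mem_squareZeroSpan (mul_mem_squareZeroSpan hv hw) m
  set E := ∑ j, c j • ((1 : R) ⊗ₜ[F] e₁ j)
  set E' := ∑ j, c' j • ((1 : R) ⊗ₜ[F] e₂ j)
  have hE : E ∈ I • (⊤ : Submodule R (R ⊗[F] U)) :=
    sum_mem fun j _ => Submodule.smul_mem_smul (Ideal.subset_span ⟨Sum.inl j, rfl⟩) trivial
  have hE' : E' ∈ I • (⊤ : Submodule R (R ⊗[F] U)) :=
    sum_mem fun j _ => Submodule.smul_mem_smul (Ideal.subset_span ⟨Sum.inr j, rfl⟩) trivial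
  have hdiff : (v + E) * (w + E') - v * w ∈ I • (⊤ : Submodule R (R ⊗[F] U)) := by
    have : (v + E) * (w + E') - v * w = v * E' + E * (w + E') := by noncomm_ring
    rw [this]
    refine add_mem ?_ ?_
    · simpa using mul_mem_ideal_smul_top (I := ⊤) (x := v) (by simp) hE'
    · simpa using mul_mem_ideal_smul_top (J := ⊤) (y := w + E') hE (by simp)
  have hmem := pow_sub_pow_mem_ideal_smul_top hdiff (k * d)
  rw [hvw, sub_zero] at hmem
  have := pow_mem_ideal_smul_top hmem ((t₁ + t₂) * (p - 1) + 1)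
  rw [hIpow] at this
  rw [pow_mul]
  simpa using this

open MvPolynomial

/-- The ideal `(X₁², …, X_D²)`. -/
noncomputable def squareIdeal (F : Type*) [Field F] (D : ℕ) : Ideal (MvPolynomial (Fin D) F) :=
  Ideal.span (Set.range fun i : Fin D => (X i ^ 2 : MvPolynomial (Fin D) F))

/-- The algebra `F[X₁, …, X_D] / (X₁², …, X_D²)`. -/
def SquareFreeAlgebra (F : Type*) [Field F] (D : ℕ) : Type _ :=
  MvPolynomial (Fin D) F ⧸ squareIdeal F D

namespace SquareFreeAlgebra

variable (F : Type*) [Field F] (D : ℕ)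

noncomputable instance : CommRing (SquareFreeAlgebra F D) :=
  inferInstanceAs (CommRing (MvPolynomial (Fin D) F ⧸ squareIdeal F D))

noncomputable instance : Algebra F (SquareFreeAlgebra F D) :=
  inferInstanceAs (Algebra F (MvPolynomial (Fin D) F ⧸ squareIdeal F D))

/-- The quotient map. -/
noncomputable def mk : MvPolynomial (Fin D) F →ₐ[F] SquareFreeAlgebra F D :=
  Ideal.Quotient.mkₐ F (squareIdeal F D)

/-- The exponent of the monomial `X₁ ⋯ X_D`. -/
noncomputable def topExponent : Fin D →₀ ℕ := ∑ i, Finsupp.single i 1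

theorem topExponent_apply (i : Fin D) : topExponent D i = 1 := by
  simp [topExponent, Finsupp.finsetSum_apply, Finsupp.single_apply]

theorem coeff_topExponent_of_mem {f : MvPolynomial (Fin D) F} (hf : f ∈ squareIdeal F D) :
    coeff (topExponent D) f = 0 := by
  obtain ⟨c, rfl⟩ := (Submodule.mem_span_range_iff_exists_fun _).1 hf
  rw [coeff_sum]
  refine Finset.sum_eq_zero fun i _ => ?_
  have hX : (X i ^ 2 : MvPolynomial (Fin D) F) = monomial (Finsupp.single i 2) 1 :=
    X_pow_eq_monomial
  rw [smul_eq_mul, hX, coeff_mul_monomial', if_neg]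
  intro hle
  have := hle i
  rw [topExponent_apply, Finsupp.single_eq_same] at this
  omega

/-- The coefficient of `X₁ ⋯ X_D`. -/
noncomputable def topCoeff : SquareFreeAlgebra F D →ₗ[F] F :=
  ((squareIdeal F D).restrictScalars F).liftQ (lcoeff F (topExponent D))
    (fun _ hf => coeff_topExponent_of_mem F D hf) ∘ₗ
    (Submodule.Quotient.restrictScalarsEquiv F (squareIdeal F D)).symm.toLinearMap

theorem topCoeff_mk (f : MvPolynomial (Fin D) F) :
    topCoeff F D (mk F D f) = coeff (topExponent D) f := rfl

variable {D} in
/-- The image of the variable `X i`. -/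
noncomputable def var (i : Fin D) : SquareFreeAlgebra F D := mk F D (X i)

theorem var_sq (i : Fin D) : var F i ^ 2 = 0 := by
  rw [var, ← map_pow]
  exact Ideal.Quotient.eq_zero_iff_mem.2 (Ideal.subset_span ⟨i, rfl⟩)

theorem topCoeff_prod_var : topCoeff F D (∏ i, var F i) = 1 := by
  have : ∏ i, var F i = mk F D (∏ i : Fin D, (X i : MvPolynomial (Fin D) F)) :=
    (map_prod _ _ _).symm
  rw [this, topCoeff_mk]
  have : ∏ i : Fin D, (X i : MvPolynomial (Fin D) F) = monomial (topExponent D) 1 :=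
    (monomial_sum_one _ _).symm
  rw [this, coeff_monomial, if_pos rfl]

variable (U : Type*) [Ring U] [Algebra F U]

/-- The coefficient of `X₁ ⋯ X_D` on the scalar extension of `U`. -/
noncomputable def topCoeffTensor : SquareFreeAlgebra F D ⊗[F] U →ₗ[F] U :=
  (TensorProduct.lid F U).toLinearMap ∘ₗ (topCoeff F D).rTensor U

theorem topCoeffTensor_tmul (c : SquareFreeAlgebra F D) (u : U) :
    topCoeffTensor F D U (c ⊗ₜ u) = topCoeff F D c • u := by
  simp [topCoeffTensor]

/-- The elements of the scalar extension of `U` of degree at most `n` in the variables. -/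
noncomputable def degreeLE (n : ℕ) : Submodule F (SquareFreeAlgebra F D ⊗[F] U) :=
  Submodule.span F {z | ∃ f : MvPolynomial (Fin D) F, ∃ u : U, f.totalDegree ≤ n ∧
    z = mk F D f ⊗ₜ[F] u}

variable {F D U}

theorem degreeLE_mono {m n : ℕ} (h : m ≤ n) : degreeLE F D U m ≤ degreeLE F D U n :=
  Submodule.span_mono fun _ ⟨f, u, hf, hz⟩ => ⟨f, u, hf.trans h, hz⟩

theorem mul_mem_degreeLE {m n : ℕ} {x y : SquareFreeAlgebra F D ⊗[F] U}
    (hx : x ∈ degreeLE F D U m) (hy : y ∈ degreeLE F D U n) : x * y ∈ degreeLE F D U (m + n) := by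
  have : degreeLE F D U m * degreeLE F D U n ≤ degreeLE F D U (m + n) := by
    rw [degreeLE, degreeLE, Submodule.span_mul_span, Submodule.span_le]
    rintro _ ⟨_, ⟨f, u, hf, rfl⟩, _, ⟨g, w, hg, rfl⟩, rfl⟩
    refine Submodule.subset_span ⟨f * g, u * w, (totalDegree_mul _ _).trans (by omega), ?_⟩
    simp only [Algebra.TensorProduct.tmul_mul_tmul, map_mul]
  exact this (Submodule.mul_mem_mul hx hy)

theorem one_mem_degreeLE (n : ℕ) : (1 : SquareFreeAlgebra F D ⊗[F] U) ∈ degreeLE F D U n :=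
  Submodule.subset_span ⟨1, 1, by simp, by simp [Algebra.TensorProduct.one_def]⟩

theorem var_tmul_mem_degreeLE (i : Fin D) (u : U) : var F i ⊗ₜ[F] u ∈ degreeLE F D U 1 :=
  Submodule.subset_span ⟨X i, u, by simp, rfl⟩

theorem pow_mem_degreeLE {m : ℕ} {x : SquareFreeAlgebra F D ⊗[F] U}
    (hx : x ∈ degreeLE F D U m) (n : ℕ) : x ^ n ∈ degreeLE F D U (n * m) := by
  induction n with
  | zero => simpa using one_mem_degreeLE 0
  | succ n ih =>
    rw [pow_succ, Nat.succ_mul]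
    exact mul_mem_degreeLE ih hx

theorem topCoeffTensor_eq_zero {n : ℕ} (hn : n < D) {x : SquareFreeAlgebra F D ⊗[F] U}
    (hx : x ∈ degreeLE F D U n) : topCoeffTensor F D U x = 0 := by
  induction hx using Submodule.span_induction with
  | mem x hx =>
    obtain ⟨f, u, hf, rfl⟩ := hx
    rw [topCoeffTensor_tmul, topCoeff_mk, coeff_eq_zero_of_totalDegree_lt, zero_smul]
    refine (hf.trans_lt hn).trans_le (le_of_eq ?_)
    rw [Finset.sum_subset (Finset.subset_univ _)
      fun i _ hi => Finsupp.notMem_support_iff.1 hi]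
    simp [topExponent_apply]
  | zero => simp
  | add x y _ _ hx hy => rw [map_add, hx, hy, add_zero]
  | smul a x _ hx => rw [map_smul, hx, smul_zero]

/-- The generic combination of `a₁, …, a_D`. -/
noncomputable def generic (a : Fin D → U) : SquareFreeAlgebra F D ⊗[F] U :=
  ∑ i, var F i ⊗ₜ[F] a i

theorem generic_eq_sum_smul (a : Fin D → U) :
    generic (F := F) a = ∑ i, var F i • ((1 : SquareFreeAlgebra F D) ⊗ₜ[F] a i) := by
  simp only [generic, TensorProduct.smul_tmul', smul_eq_mul, mul_one]

theorem generic_add (a b : Fin D → U) :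
    generic (F := F) (a + b) = generic a + generic b := by
  simp only [generic, Pi.add_apply, TensorProduct.tmul_add, Finset.sum_add_distrib]

theorem generic_mem_degreeLE (a : Fin D → U) : generic a ∈ degreeLE F D U 1 :=
  sum_mem fun i _ => var_tmul_mem_degreeLE i (a i)

theorem generic_mem_squareZeroSpan {S : Submodule F U} {a : Fin D → U} (ha : ∀ i, a i ∈ S) :
    generic a ∈ squareZeroSpan (SquareFreeAlgebra F D) S :=
  sum_mem fun i _ => tmul_mem_squareZeroSpan (var_sq F D i) (ha i)

theorem generic_pow_succ_eq_zero (a : Fin D → U) : generic (F := F) a ^ (D + 1) = 0 := by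
  rw [generic_eq_sum_smul, sum_smul_pow_eq_sum_injective _ _ (var_sq F D)]
  refine Finset.sum_eq_zero fun r hr => ?_
  have := Fintype.card_le_of_injective r (Finset.mem_filter.1 hr).2
  simp at this

theorem topCoeffTensor_generic_pow (a : Fin D → U) :
    topCoeffTensor F D U (generic a ^ D)
      = ∑ σ : Equiv.Perm (Fin D), (List.ofFn fun i => a (σ i)).prod := by
  rw [generic_eq_sum_smul, sum_smul_pow_eq_sum_injective _ _ (var_sq F D), map_sum]
  symm
  refine Finset.sum_bij (fun σ _ => σ) ?_ ?_ ?_ ?_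
  · intro σ _
    simp [σ.injective]
  · intro σ _ τ _ h
    exact DFunLike.coe_injective h
  · intro r hr
    exact ⟨Equiv.ofBijective r (Finite.injective_iff_bijective.1 (Finset.mem_filter.1 hr).2),
      Finset.mem_univ _, rfl⟩
  · intro σ _
    rw [prod_ofFn_one_tmul, TensorProduct.smul_tmul', smul_eq_mul, mul_one, topCoeffTensor_tmul,
      Equiv.prod_comp σ (var F), topCoeff_prod_var, one_smul]

/-- The symmetric sum vanishes as soon as `1 - generic a` has an inverse of degree below `D`. -/
theorem symmetric_sum_eq_zero_of_inverse {n : ℕ} (hn : n < D) {a : Fin D → U}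
    {G : SquareFreeAlgebra F D ⊗[F] U} (hG : G ∈ degreeLE F D U n)
    (h : (1 - generic a) * G = 1) :
    ∑ σ : Equiv.Perm (Fin D), (List.ofFn fun i => a (σ i)).prod = 0 := by
  have hgeom := geom_sum_mul_neg (generic (F := F) a) (D + 1)
  rw [generic_pow_succ_eq_zero, sub_zero] at hgeom
  have hGeq : ∑ j ∈ Finset.range (D + 1), generic a ^ j = G := left_inv_eq_right_inv hgeom h
  have hlow : ∑ j ∈ Finset.range D, topCoeffTensor F D U (generic a ^ j) = 0 := by
    refine Finset.sum_eq_zero fun j hj => topCoeffTensor_eq_zero (Finset.mem_range.1 hj) ?_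
    simpa using pow_mem_degreeLE (generic_mem_degreeLE a) j
  have := topCoeffTensor_eq_zero hn hG
  rwa [← hGeq, map_sum, Finset.sum_range_succ, hlow, zero_add, topCoeffTensor_generic_pow] at this

end SquareFreeAlgebra

open SquareFreeAlgebra in
/-- The positive powers of a generic element of a subalgebra sum to an element `P` of degree less
than the nilpotency index, and `1 + P` is the inverse of `1 - x`. -/
theorem exists_inverse_one_sub_generic {F U : Type*} [Field F] [Ring U] [Algebra F U] {D d : ℕ}
    {S : Submodule F U} (hS : S * S ≤ S) (hd : 0 < d)
    (hsym : ∀ a : Fin d → U, (∀ i, a i ∈ S) →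
      ∑ σ : Equiv.Perm (Fin d), (List.ofFn fun i => a (σ i)).prod = 0)
    {a : Fin D → U} (ha : ∀ i, a i ∈ S) :
    ∃ P ∈ squareZeroSpan (SquareFreeAlgebra F D) S, P ∈ degreeLE F D U (d - 1) ∧
      (1 + P) * (1 - generic a) = 1 ∧ (1 - generic a) * (1 + P) = 1 := by
  have hmem := generic_mem_squareZeroSpan ha
  have hpow : generic (F := F) a ^ d = 0 := pow_eq_zero_of_mem_squareZeroSpan hsym hmem
  have hgeom : 1 + ∑ r ∈ Finset.range (d - 1), generic (F := F) a ^ (r + 1)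
      = ∑ r ∈ Finset.range d, generic a ^ r := by
    obtain ⟨m, rfl⟩ := Nat.exists_eq_succ_of_ne_zero hd.ne'
    rw [Finset.sum_range_succ', pow_zero, add_comm]
    rfl
  refine ⟨∑ r ∈ Finset.range (d - 1), generic a ^ (r + 1), sum_mem fun r _ => ?_,
    sum_mem fun r hr => ?_, ?_, ?_⟩
  · clear * - hS hmem
    induction r with
    | zero => simpa using hmem
    | succ r ih =>
      rw [pow_succ]
      exact squareZeroSpan_mono hS (mul_mem_squareZeroSpan ih hmem)
  · refine degreeLE_mono ?_ (pow_mem_degreeLE (generic_mem_degreeLE a) (r + 1))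
    have := Finset.mem_range.1 hr
    omega
  · rw [hgeom, geom_sum_mul_neg, hpow, sub_zero]
  · rw [hgeom, mul_neg_geom_sum, hpow, sub_zero]

open SquareFreeAlgebra in
/-- The symmetric identity for a sum of two subalgebras, inside a unital algebra. -/
theorem symmetric_sum_add_eq_zero {F U : Type*} [Field F] [Ring U] [Algebra F U]
    {p : ℕ} (hp : p.Prime) [CharP F p]
    {S₁ S₂ V₁ V₂ W : Submodule F U} {t₁ t₂ k d₁ d₂ d D : ℕ} {e₁ : Fin t₁ → U} {e₂ : Fin t₂ → U}
    (hS₁ : S₁ * S₁ ≤ S₁) (hS₂ : S₂ * S₂ ≤ S₂)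
    (he₁ : ∀ s ∈ S₁, ∃ φ : Fin t₁ → F, s - ∑ j, φ j • e₁ j ∈ V₁)
    (he₂ : ∀ s ∈ S₂, ∃ φ : Fin t₂ → F, s - ∑ j, φ j • e₂ j ∈ V₂)
    (hk : 0 < k) (hVW : (V₁ * V₂) ^ k ≤ W) (hd₁ : 0 < d₁) (hd₂ : 0 < d₂)
    (hsym₁ : ∀ a : Fin d₁ → U, (∀ i, a i ∈ S₁) →
      ∑ σ : Equiv.Perm (Fin d₁), (List.ofFn fun i => a (σ i)).prod = 0)
    (hsym₂ : ∀ a : Fin d₂ → U, (∀ i, a i ∈ S₂) →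
      ∑ σ : Equiv.Perm (Fin d₂), (List.ofFn fun i => a (σ i)).prod = 0)
    (hsymW : ∀ a : Fin d → U, (∀ i, a i ∈ W) →
      ∑ σ : Equiv.Perm (Fin d), (List.ofFn fun i => a (σ i)).prod = 0)
    (hD : k * d * ((t₁ + t₂) * (p - 1) + 1) * (d₁ - 1 + (d₂ - 1)) < D)
    {a₁ a₂ : Fin D → U} (ha₁ : ∀ i, a₁ i ∈ S₁) (ha₂ : ∀ i, a₂ i ∈ S₂) :
    ∑ σ : Equiv.Perm (Fin D), (List.ofFn fun i => (a₁ + a₂) (σ i)).prod = 0 := by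
  obtain ⟨P, hP, hPdeg, hPl, hPr⟩ :=
    exists_inverse_one_sub_generic (D := D) hS₁ hd₁ hsym₁ ha₁
  obtain ⟨Q, hQ, hQdeg, -, hQr⟩ :=
    exists_inverse_one_sub_generic (D := D) hS₂ hd₂ hsym₂ ha₂
  have hPQ := pow_mul_eq_zero_of_mem_squareZeroSpan hp he₁ he₂ hk hVW hsymW hP hQ
  set n := k * d * ((t₁ + t₂) * (p - 1) + 1)
  have hh := mul_neg_geom_sum (P * Q) n
  rw [hPQ, sub_zero] at hh
  have hG := one_sub_add_mul_eq_one hPl hPr hQr hh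
  rw [← generic_add] at hG
  refine symmetric_sum_eq_zero_of_inverse hD ?_ hG
  rw [mul_assoc (1 + Q), Finset.sum_mul, Finset.mul_sum]
  refine sum_mem fun q hq => ?_
  have hle : d₂ - 1 + (q * (d₁ - 1 + (d₂ - 1)) + (d₁ - 1)) ≤ n * (d₁ - 1 + (d₂ - 1)) := by
    have := Nat.mul_le_mul_right (d₁ - 1 + (d₂ - 1)) (Nat.succ_le_of_lt (Finset.mem_range.1 hq))
    rw [Nat.succ_mul] at this
    omega
  exact degreeLE_mono hle (mul_mem_degreeLE
    (add_mem (one_mem_degreeLE _) hQdeg) (mul_mem_degreeLE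
      (pow_mem_degreeLE (mul_mem_degreeLE hPdeg hQdeg) q) (add_mem (one_mem_degreeLE _) hPdeg)))

/-- A subspace of codimension `t` has a complement spanned by `t` vectors. -/
theorem exists_fin_sub_sum_mem_map {F M U : Type*} [Field F] [AddCommGroup M] [Module F M]
    [AddCommGroup U] [Module F U] (f : M →ₗ[F] U) (V : Submodule F M) {t : ℕ}
    [FiniteDimensional F (M ⧸ V)] (ht : Module.finrank F (M ⧸ V) = t) :
    ∃ e : Fin t → U, ∀ s ∈ LinearMap.range f, ∃ φ : Fin t → F,
      s - ∑ j, φ j • e j ∈ V.map f := by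
  let b := Module.finBasisOfFinrankEq F (M ⧸ V) ht
  choose e he using fun j => V.mkQ_surjective (b j)
  refine ⟨fun j => f (e j), ?_⟩
  rintro _ ⟨s, rfl⟩
  refine ⟨b.repr (V.mkQ s), s - ∑ j, b.repr (V.mkQ s) j • e j, ?_, by simp⟩
  rw [SetLike.mem_coe, ← Submodule.Quotient.mk_eq_zero, ← Submodule.mkQ_apply, map_sub, map_sum]
  simp only [map_smul, he, b.sum_repr, sub_self]

theorem SatisfiesSymIdOn.pos {F A : Type*} [Field F] [NonUnitalRing A]
    [Module F A] [SMulCommClass F A A] [IsScalarTower F A A] {S : Set A} {d : ℕ}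
    (h : SatisfiesSymIdOn F S d) : 0 < d := by
  rcases Nat.eq_zero_or_pos d with rfl | hd
  · have := h Fin.elim0 fun i => i.elim0
    simp [symSum, permProd] at this
  · exact hd

/-- The inclusion of a subalgebra of `A` in the unitization of `A`. -/
def subalgebraToUnitization {F A : Type*} [Field F] [NonUnitalRing A]
    [Module F A] [SMulCommClass F A A] [IsScalarTower F A A] (S : NonUnitalSubalgebra F A) :
    S →ₗ[F] Unitization F A where
  toFun x := Unitization.inr (x : A)
  map_add' x y := by simp
  map_smul' c x := by simp

theorem range_subalgebraToUnitization_mul_le {F A : Type*} [Field F] [NonUnitalRing A]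
    [Module F A] [SMulCommClass F A A] [IsScalarTower F A A] (S : NonUnitalSubalgebra F A) :
    LinearMap.range (subalgebraToUnitization S) * LinearMap.range (subalgebraToUnitization S)
      ≤ LinearMap.range (subalgebraToUnitization S) := by
  rw [Submodule.mul_le]
  rintro _ ⟨x, rfl⟩ _ ⟨y, rfl⟩
  exact ⟨x * y, by simp [subalgebraToUnitization]⟩

theorem SatisfiesSymIdOn.range_subalgebraToUnitization {F A : Type*} [Field F] [NonUnitalRing A]
    [Module F A] [SMulCommClass F A A] [IsScalarTower F A A] {S : NonUnitalSubalgebra F A} {d : ℕ}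
    (h : SatisfiesSymIdOn F (S : Set A) d) (a : Fin d → Unitization F A)
    (ha : ∀ i, a i ∈ LinearMap.range (subalgebraToUnitization S)) :
    ∑ σ : Equiv.Perm (Fin d), (List.ofFn fun i => a (σ i)).prod = 0 := by
  choose b hb using ha
  obtain rfl : (fun i => subalgebraToUnitization S (b i)) = a := funext hb
  exact h (fun i => b i) fun i => (b i).2

theorem map_mul_map_pow_le {F A : Type*} [Field F] [NonUnitalRing A]
    [Module F A] [SMulCommClass F A A] [IsScalarTower F A A] {A₁ A₂ W : NonUnitalSubalgebra F A}
    {V₁ : Submodule F A₁} {V₂ : Submodule F A₂} {k : ℕ}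
    (hprod : ∀ v : Fin k → A₁, ∀ w : Fin k → A₂,
      (∀ j, v j ∈ V₁) → (∀ j, w j ∈ V₂) →
      ∃ x ∈ W, (List.ofFn fun j => (Unitization.inr (v j : A) * Unitization.inr (w j : A) :
        Unitization F A)).prod = Unitization.inr x) :
    (V₁.map (subalgebraToUnitization A₁) * V₂.map (subalgebraToUnitization A₂)) ^ k
      ≤ LinearMap.range (subalgebraToUnitization W) := by
  rw [Submodule.mul_eq_span_mul_set, Submodule.span_pow, Submodule.span_le]
  intro z hz
  obtain ⟨f, rfl⟩ := Set.mem_pow.1 hz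
  choose v hv w hw hvw using fun j => (f j).2
  choose v' hv' hvv' using hv
  choose w' hw' hww' using hw
  obtain ⟨x, hx, hxe⟩ := hprod v' w' hv' hw'
  refine ⟨⟨x, hx⟩, ?_⟩
  refine hxe.symm.trans (congrArg List.prod (congrArg List.ofFn (funext fun j => ?_)))
  rw [← hvw, ← hvv', ← hww']
  rfl

theorem symmetric_degree_bound {d₁ d₂ m T : ℕ} (hd₁ : 0 < d₁) (hd₂ : 0 < d₂) :
    m * T * (d₁ - 1 + (d₂ - 1)) < ((d₁ + d₂ - 2) * (m + 2) - 1) * T + 1 := by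
  have hδ : d₁ - 1 + (d₂ - 1) = d₁ + d₂ - 2 := by omega
  rw [hδ]
  generalize d₁ + d₂ - 2 = δ
  rcases Nat.eq_zero_or_pos δ with rfl | h
  · simp
  · have : m * δ ≤ δ * (m + 2) - 1 := by
      rw [mul_add, mul_comm m]
      omega
    rw [Nat.lt_succ_iff, mul_right_comm]
    exact Nat.mul_le_mul_right T this



/-- Theorem 1 of the paper. -/
theorem sum_of_PI_algebras_symmetric_identity
    (F A : Type*) [Field F] [Infinite F] (p : ℕ) [CharP F p] (hp : 0 < p)
    [NonUnitalRing A] [Module F A] [SMulCommClass F A A] [IsScalarTower F A A]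
    (A₁ A₂ : NonUnitalSubalgebra F A)
    (hsum : ∀ a : A, ∃ a₁ ∈ A₁, ∃ a₂ ∈ A₂, a = a₁ + a₂)
    (d₁ d₂ : ℕ)
    (h₁ : SatisfiesSymIdOn F (A₁ : Set A) d₁)
    (h₂ : SatisfiesSymIdOn F (A₂ : Set A) d₂)
    (k : ℕ) (hk : 0 < k) (i : Fin 2)
    (V₁ : Submodule F A₁) (V₂ : Submodule F A₂) (t₁ t₂ : ℕ)
    [FiniteDimensional F (A₁ ⧸ V₁)] [FiniteDimensional F (A₂ ⧸ V₂)]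
    (ht₁ : Module.finrank F (A₁ ⧸ V₁) = t₁)
    (ht₂ : Module.finrank F (A₂ ⧸ V₂) = t₂)
    (hprod : ∀ v : Fin k → A₁, ∀ w : Fin k → A₂,
      (∀ j, v j ∈ V₁) → (∀ j, w j ∈ V₂) →
      ∃ x ∈ (if i = 0 then A₁ else A₂),
        (List.ofFn fun j => (Unitization.inr (v j : A) * Unitization.inr (w j : A) :
            Unitization F A)).prod = Unitization.inr x) :
    SatisfiesSymId F A
      (((d₁ + d₂ - 2) * (k * (if i = 0 then d₁ else d₂) + 2) - 1) *
        ((t₁ + t₂) * (p - 1) + 1) + 1) := by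
  classical
  have hpp : p.Prime := (CharP.char_is_prime_or_zero F p).resolve_right hp.ne'
  obtain ⟨e₁, he₁⟩ := exists_fin_sub_sum_mem_map (subalgebraToUnitization A₁) V₁ ht₁
  obtain ⟨e₂, he₂⟩ := exists_fin_sub_sum_mem_map (subalgebraToUnitization A₂) V₂ ht₂
  have hW : SatisfiesSymIdOn F ((if i = 0 then A₁ else A₂ : NonUnitalSubalgebra F A) : Set A)
      (if i = 0 then d₁ else d₂) := by
    split_ifs <;> assumption
  intro a
  choose a₁ ha₁ a₂ ha₂ haa using fun j => hsum (a j)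
  have key := symmetric_sum_add_eq_zero hpp (range_subalgebraToUnitization_mul_le A₁)
    (range_subalgebraToUnitization_mul_le A₂) he₁ he₂ hk (map_mul_map_pow_le hprod) h₁.pos h₂.pos
    h₁.range_subalgebraToUnitization h₂.range_subalgebraToUnitization
    hW.range_subalgebraToUnitization (symmetric_degree_bound h₁.pos h₂.pos)
    (fun j => ⟨⟨a₁ j, ha₁ j⟩, rfl⟩) (fun j => ⟨⟨a₂ j, ha₂ j⟩, rfl⟩)
  refine Eq.trans (Finset.sum_congr rfl fun σ _ => congrArg List.prod
    (congrArg List.ofFn (funext fun j => ?_))) key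
  rw [haa, Unitization.inr_add]
  rfl
end

section
/- Let F be an infinite field of characteristic p > 0, let A be a (possibly non-unital) associative F-algebra, and let A₁, A₂ be subalgebras of A with A = A₁ + A₂. Suppose A₁ satisfies the symmetric identity of degree d₁ and A₂ satisfies the symmetric identity of degree d₂. Assume there exist an integer k > 0, an index i ∈ {1,2}, and two-sided ideals I₁ of A₁ and I₂ of A₂, each of finite codimension in A₁ and A₂ respectively, such that every product of the form v₁w₁v₂w₂⋯v_k w_k with v₁,…,v_k ∈ I₁ and w₁,…,w_k ∈ I₂ lies in A_i. Then there exists an integer D ≥ 1 such that A satisfies the symmetric identity of degree D; in particular A is a PI-algebra. -/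
/-- Every algebra is an algebra over its center. -/
instance Subalgebra.centerAlgebra (F E : Type*) [CommRing F] [Ring E] [Algebra F E] :
    Algebra (Subalgebra.center F E) E :=
  Algebra.ofModule (fun r x y => smul_mul_assoc r x y) (fun r x y => by
    change x * ((r : E) * y) = (r : E) * (x * y)
    rw [← mul_assoc, ← mul_assoc, Subalgebra.mem_center_iff.1 r.2 x])

/-- The subset `M` of the ring `R` satisfies the symmetric identity of degree `d`. -/
def IsSymId {R : Type*} [Semiring R] (M : Set R) (d : ℕ) : Prop :=
  ∀ b : Fin d → R, (∀ i, b i ∈ M) →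
    ∑ σ : Equiv.Perm (Fin d), (List.ofFn fun i => b (σ i)).prod = 0

/-- The power of a sum whose coefficients have square zero is a combination of symmetric sums. -/
theorem sum_smul_pow_of_sq_eq_zero {Z E : Type*} [CommRing Z] [Ring E] [Algebra Z E]
    {m : ℕ} (n : ℕ) (z : Fin m → Z) (hz : ∀ j, z j ^ 2 = 0) (y : Fin m → E) :
    (∑ j, z j • y j) ^ n = ∑ s : Set.powersetCard (Fin m) n, (∏ j ∈ s.1, z j) •
      ∑ σ : Equiv.Perm (Fin n), (List.ofFn fun i => y (s.1.orderEmbOfFin s.2 (σ i))).prod := by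
  classical
  have expand : (∑ j, z j • y j) ^ n =
      ∑ φ : Fin n → Fin m, (∏ i, z (φ i)) • (List.ofFn fun i => y (φ i)).prod := by
    rw [← MultilinearMap.mkPiAlgebraFin_apply_const (R := Z), MultilinearMap.map_sum]
    simp_rw [MultilinearMap.map_smul_univ, MultilinearMap.mkPiAlgebraFin_apply]
  have noninj (φ : Fin n → Fin m) (hφ : ¬ Function.Injective φ) : ∏ i, z (φ i) = 0 := by
    simp only [Function.Injective, not_forall] at hφ
    obtain ⟨a, b, hab, hne⟩ := hφ
    rw [← Finset.mul_prod_erase _ _ (Finset.mem_univ a),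
      ← Finset.mul_prod_erase _ _ (Finset.mem_erase.2 ⟨Ne.symm hne, Finset.mem_univ b⟩),
      ← mul_assoc, hab, ← pow_two, hz, zero_mul]
  rw [expand]
  simp_rw [Finset.smul_sum]
  rw [← Fintype.sum_sigma' (f := fun (s : Set.powersetCard (Fin m) n) (σ : Equiv.Perm (Fin n)) =>
    (∏ j ∈ s.1, z j) • (List.ofFn fun i => y (s.1.orderEmbOfFin s.2 (σ i))).prod)]
  symm
  refine Finset.sum_of_injOn (fun q i => q.1.1.orderEmbOfFin q.1.2 (q.2 i)) ?_ (by simp) ?_ ?_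
  · rintro ⟨s, σ⟩ - ⟨t, τ⟩ - h
    have hs (u : Set.powersetCard (Fin m) n) (ρ : Equiv.Perm (Fin n)) :
        Set.range (fun i => u.1.orderEmbOfFin u.2 (ρ i)) = u.1 := by
      rw [← Finset.range_orderEmbOfFin u.1 u.2]
      exact ρ.surjective.range_comp _
    have hst : s = t := by
      apply Subtype.ext
      apply Finset.coe_injective
      rw [← hs s σ, ← hs t τ]
      exact congrArg Set.range h
    subst hst
    have : σ = τ := Equiv.ext fun i => (s.1.orderEmbOfFin s.2).injective (congrFun h i)
    rw [this]
  · intro φ _ hφ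
    rw [noninj φ, zero_smul]
    intro hinj
    apply hφ
    have hcard : (Finset.univ.image φ).card = n := by
      rw [Finset.card_image_of_injective _ hinj, Finset.card_fin]
    let e := (Finset.univ.image φ).orderIsoOfFin hcard
    let σ : Fin n → Fin n := fun i => e.symm ⟨φ i, by simp⟩
    have hσ : Function.Injective σ := fun a b h => hinj (by simpa [σ] using h)
    refine ⟨⟨⟨_, hcard⟩, Equiv.ofBijective σ (Finite.injective_iff_bijective.1 hσ)⟩, by simp, ?_⟩
    funext i
    exact congrArg Subtype.val (e.apply_symm_apply ⟨φ i, by simp⟩)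
  · rintro ⟨s, σ⟩ -
    congr 1
    have hmap := Finset.prod_map Finset.univ (s.1.orderEmbOfFin s.2).toEmbedding z
    have huniv := Finset.map_orderEmbOfFin_univ s.1 s.2
    exact (congrArg (fun a => ∏ j ∈ a, z j) huniv).symm.trans <| hmap.trans (Equiv.prod_comp σ fun i => z (s.1.orderEmbOfFin s.2 i)).symm

section

variable {F R E : Type*} [Field F] [Ring R] [Algebra F R] [Ring E] [Algebra F E]

/-- The span of the image of `M` under `f` with central coefficients of square zero. -/
def sqZeroSpan (f : R →ₐ[F] E) (M : Set R) : Submodule F E :=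
  Submodule.span F {x | ∃ z : Subalgebra.center F E, z ^ 2 = 0 ∧ ∃ m ∈ M, x = z • f m}

theorem smul_mem_sqZeroSpan (f : R →ₐ[F] E) {M : Set R} {z : Subalgebra.center F E}
    (hz : z ^ 2 = 0) {m : R} (hm : m ∈ M) : z • f m ∈ sqZeroSpan f M :=
  Submodule.subset_span ⟨z, hz, m, hm, rfl⟩

theorem mul_mem_sqZeroSpan (f : R →ₐ[F] E) {M N K : Set R}
    (h : ∀ m ∈ M, ∀ n ∈ N, m * n ∈ K) {x y : E}
    (hx : x ∈ sqZeroSpan f M) (hy : y ∈ sqZeroSpan f N) : x * y ∈ sqZeroSpan f K := by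
  have hle : sqZeroSpan f M * sqZeroSpan f N ≤ sqZeroSpan f K := by
    rw [sqZeroSpan, sqZeroSpan, Submodule.span_mul_span, Submodule.span_le]
    rintro _ ⟨_, ⟨z, hz, m, hm, rfl⟩, _, ⟨w, hw, n, hn, rfl⟩, rfl⟩
    simp only [smul_mul_smul_comm, ← map_mul]
    exact smul_mem_sqZeroSpan f (by rw [mul_pow, hz, zero_mul]) (h m hm n hn)
  exact hle (Submodule.mul_mem_mul hx hy)

theorem pow_succ_mem_sqZeroSpan (f : R →ₐ[F] E) {M : Set R} (h : ∀ m ∈ M, ∀ n ∈ M, m * n ∈ M)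
    {x : E} (hx : x ∈ sqZeroSpan f M) (n : ℕ) : x ^ (n + 1) ∈ sqZeroSpan f M := by
  induction n with
  | zero => simpa using hx
  | succ n ih => rw [pow_succ]; exact mul_mem_sqZeroSpan f h ih hx

theorem pow_eq_zero_of_mem_sqZeroSpan (f : R →ₐ[F] E) {M : Set R} {d : ℕ} (hM : IsSymId M d)
    {x : E} (hx : x ∈ sqZeroSpan f M) : x ^ d = 0 := by
  obtain ⟨m, c, g, rfl⟩ := Submodule.mem_span_set'.1 hx
  choose z hz b hb hg using fun j => (g j).2
  have : ∑ j, c j • (g j : E) = ∑ j, (c j • z j) • f (b j) :=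
    Finset.sum_congr rfl fun j _ => by rw [hg, smul_assoc]
  rw [this, sum_smul_pow_of_sq_eq_zero _ _ fun j => by rw [smul_pow, hz, smul_zero]]
  refine Finset.sum_eq_zero fun s _ => ?_
  have key := congrArg f (hM (fun i => b (s.1.orderEmbOfFin s.2 i)) fun i => hb _)
  rw [map_sum, map_zero] at key
  rw [← smul_zero (∏ j ∈ s.1, c j • z j), ← key]
  congr 1
  refine Finset.sum_congr rfl fun σ _ => ?_
  rw [map_list_prod, List.map_ofFn]
  rfl

/-- If products `v₁w₁⋯vₖwₖ` lie in `K`, so do the corresponding products of spans. -/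
theorem mul_pow_mem_sqZeroSpan (f : R →ₐ[F] E) {M N K : Set R} {k : ℕ} (hk : 0 < k)
    (h : ∀ v w : Fin k → R, (∀ j, v j ∈ M) → (∀ j, w j ∈ N) →
      (List.ofFn fun j => v j * w j).prod ∈ K) {x y : E}
    (hx : x ∈ sqZeroSpan f M) (hy : y ∈ sqZeroSpan f N) :
    (x * y) ^ k ∈ sqZeroSpan f K := by
  have hxy := mul_mem_sqZeroSpan f (K := {r | ∃ m ∈ M, ∃ n ∈ N, m * n = r})
    (fun m hm n hn => ⟨m, hm, n, hn, rfl⟩) hx hy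
  have hpow := Submodule.pow_mem_pow _ hxy k
  rw [sqZeroSpan, Submodule.span_pow] at hpow
  refine Submodule.span_le.2 ?_ hpow
  intro a ha
  obtain ⟨g, rfl⟩ := Set.mem_pow.1 ha
  choose z hz b hb hg using fun j => (g j).2
  choose v hv w hw hvw using hb
  have : (List.ofFn fun i => (g i : E)).prod =
      (∏ i, z i) • f (List.ofFn fun j => v j * w j).prod := by
    simp_rw [hg, ← MultilinearMap.mkPiAlgebraFin_apply (R := Subalgebra.center F E),
      MultilinearMap.map_smul_univ, MultilinearMap.mkPiAlgebraFin_apply, map_list_prod,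
      List.map_ofFn, hvw]
    rfl
  rw [this]
  refine smul_mem_sqZeroSpan f ?_ (h v w hv hw)
  rw [← Finset.prod_pow]
  exact Finset.prod_eq_zero (Finset.mem_univ ⟨0, hk⟩) (hz _)


open Polynomial in
theorem X_mul_C_mem_sqZeroSpan (f : R →ₐ[F] E) {M : Set R} {x : E} (hx : x ∈ sqZeroSpan f M) :
    X * C x ∈ sqZeroSpan ((CAlgHom : E →ₐ[F] E[X]).comp f) M := by
  induction hx using Submodule.span_induction with
  | zero => simp
  | add a b _ _ ha hb => rw [C_add, mul_add]; exact add_mem ha hb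
  | smul c a _ ha =>
    rw [← smul_C, mul_smul_comm]
    exact Submodule.smul_mem _ c ha
  | mem a ha =>
    obtain ⟨z, hz, m, hm, rfl⟩ := ha
    have hz' : (z : E) ^ 2 = 0 := by simpa using congrArg Subtype.val hz
    have hcomm (y : E) : y * z = z * y := Subalgebra.mem_center_iff.1 z.2 y
    have hmem : X * C (z : E) ∈ Subalgebra.center F E[X] := by
      refine Subalgebra.mem_center_iff.2 fun q => ?_
      rw [← mul_assoc, ← X_mul, mul_assoc, mul_assoc]
      congr 1
      ext n
      rw [coeff_mul_C, coeff_C_mul, hcomm]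
    have key := smul_mem_sqZeroSpan ((CAlgHom : E →ₐ[F] E[X]).comp f) (M := M)
      (z := ⟨X * C (z : E), hmem⟩) (m := m) ?_ hm
    · convert key using 1
      change X * C ((z : E) * f m) = X * C (z : E) * C (f m)
      rw [C_mul, mul_assoc]
    · apply Subtype.ext
      change (X * C (z : E)) ^ 2 = 0
      rw [(commute_X _).mul_pow, ← C_pow, hz', C_0, mul_zero]

end

open Polynomial in
/-- If `1 - aX` has a polynomial right inverse of degree at most `N`, then `a ^ (N + 1) = 0`. -/
theorem pow_eq_zero_of_one_sub_X_mul_C_mul_eq_one {E : Type*} [Ring E] {a : E} {Q : E[X]} {N : ℕ}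
    (hQ : (1 - X * C a) * Q = 1) (hN : Q.natDegree ≤ N) : a ^ (N + 1) = 0 := by
  have hQ' : Q = 1 + X * (C a * Q) := by
    rw [sub_mul, one_mul, sub_eq_iff_eq_add] at hQ
    rw [← mul_assoc]
    exact hQ
  have hcoeff (n : ℕ) : Q.coeff n = a ^ n := by
    induction n with
    | zero => rw [hQ']; simp
    | succ n ih =>
      rw [hQ', coeff_add, coeff_X_mul, coeff_C_mul, ih, coeff_one, if_neg (by simp), zero_add,
        pow_succ']
  rw [← hcoeff, coeff_eq_zero_of_natDegree_lt (by lia)]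

/-- Inverting `1 - x - y` from inverses of `1 - x`, `1 - y` and `1 - u * v`. -/
theorem one_sub_add_mul_eq_one_s2 {E : Type*} [Ring E] {x y u v W : E}
    (hxu : (1 - x) * (1 + u) = 1) (hyv : (1 - y) * (1 + v) = 1)
    (hW : (1 - u * v) * W = 1) : (1 - (x + y)) * ((1 + v) * W * (1 + u)) = 1 := by
  have hx : x = (1 - x) * u := by
    rw [mul_add, mul_one] at hxu
    rw [eq_sub_of_add_eq' hxu, sub_sub_cancel]
  have key : (1 - (x + y)) * (1 + v) = (1 - x) * (1 - u * v) := by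
    calc (1 - (x + y)) * (1 + v) = (1 - y) * (1 + v) - x - x * v := by noncomm_ring
      _ = 1 - x - (1 - x) * u * v := by rw [hyv, ← hx]
      _ = (1 - x) * (1 - u * v) := by noncomm_ring
  rw [← mul_assoc, ← mul_assoc, key, mul_assoc (1 - x), hW, mul_one, hxu]

theorem one_sub_mul_one_add_sum_pow {E : Type*} [Ring E] {x : E} {d : ℕ} (hx : x ^ d = 0) :
    (1 - x) * (1 + ∑ i ∈ Finset.range d, x ^ (i + 1)) = 1 := by
  rw [add_comm, ← pow_zero x, ← Finset.sum_range_succ', pow_zero, mul_neg_geom_sum, pow_succ, hx,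
    zero_mul, sub_zero]

section

variable {F R E : Type*} [Field F] [Ring R] [Algebra F R] [Ring E] [Algebra F E]

open Polynomial in
theorem add_pow_eq_zero_of_mem_sqZeroSpan (f : R →ₐ[F] E) {M N K : Set R} {k d d₁ d₂ : ℕ}
    (hk : 0 < k) (hMM : ∀ m ∈ M, ∀ n ∈ M, m * n ∈ M) (hNN : ∀ m ∈ N, ∀ n ∈ N, m * n ∈ N)
    (hM : IsSymId M d₁) (hN : IsSymId N d₂) (hK : IsSymId K d)
    (h : ∀ v w : Fin k → R, (∀ j, v j ∈ M) → (∀ j, w j ∈ N) →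
      (List.ofFn fun j => v j * w j).prod ∈ K) {x y : E}
    (hx : x ∈ sqZeroSpan f M) (hy : y ∈ sqZeroSpan f N) :
    (x + y) ^ (d₂ + k * d * (d₁ + d₂) + d₁ + 1) = 0 := by
  have hX := X_mul_C_mem_sqZeroSpan f hx
  have hY := X_mul_C_mem_sqZeroSpan f hy
  set g := (CAlgHom : E →ₐ[F] E[X]).comp f
  have hdeg (a : E) (n : ℕ) :
      (∑ i ∈ Finset.range n, (X * C a) ^ (i + 1)).natDegree ≤ n := by
    refine natDegree_sum_le_of_forall_le _ _ fun i hi => ?_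
    have h1 : (X * C a).natDegree ≤ 1 :=
      (natDegree_mul_C_le _ _).trans natDegree_X_le
    have := natDegree_pow_le_of_le (i + 1) h1
    rw [Finset.mem_range] at hi
    lia
  set u := ∑ i ∈ Finset.range d₁, (X * C x) ^ (i + 1)
  set v := ∑ i ∈ Finset.range d₂, (X * C y) ^ (i + 1)
  have hug : u ∈ sqZeroSpan g M := sum_mem fun i _ => pow_succ_mem_sqZeroSpan g hMM hX i
  have hvg : v ∈ sqZeroSpan g N := sum_mem fun i _ => pow_succ_mem_sqZeroSpan g hNN hY i
  have huv : (u * v) ^ (k * d) = 0 := by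
    rw [pow_mul]
    exact pow_eq_zero_of_mem_sqZeroSpan g hK (mul_pow_mem_sqZeroSpan g hk h hug hvg)
  have hW : (1 - u * v) * ∑ i ∈ Finset.range (k * d), (u * v) ^ i = 1 := by
    rw [mul_neg_geom_sum, huv, sub_zero]
  have hinv := one_sub_add_mul_eq_one_s2
    (one_sub_mul_one_add_sum_pow (pow_eq_zero_of_mem_sqZeroSpan g hM hX))
    (one_sub_mul_one_add_sum_pow (pow_eq_zero_of_mem_sqZeroSpan g hN hY)) hW
  rw [← mul_add, ← C_add] at hinv
  refine pow_eq_zero_of_one_sub_X_mul_C_mul_eq_one hinv ?_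
  have hone {q : E[X]} {n : ℕ} (hq : q.natDegree ≤ n) : (1 + q).natDegree ≤ n :=
    natDegree_add_le_of_degree_le (by simp) hq
  refine natDegree_mul_le_of_le (natDegree_mul_le_of_le (hone (hdeg y d₂)) ?_) (hone (hdeg x d₁))
  refine natDegree_sum_le_of_forall_le _ _ fun i hi => ?_
  refine (natDegree_pow_le_of_le i (natDegree_mul_le_of_le (hdeg x d₁) (hdeg y d₂))).trans ?_
  exact Nat.mul_le_mul_right _ (Finset.mem_range.1 hi).le

end

/-- Adding a central multiple `l • w` with `l ^ p = 0` preserves nilpotency with control of the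
exponent. -/
theorem add_smul_pow_mul_eq_zero {Z E : Type*} [CommRing Z] [Ring E] [Algebra Z E] {g : E}
    {n p : ℕ} (hg : g ^ n = 0) {l : Z} (hl : l ^ p = 0) (w : E) : (g + l • w) ^ (n * p) = 0 := by
  have hdvd (m : ℕ) : ∃ h : E, (g + l • w) ^ m = g ^ m + l • h := by
    induction m with
    | zero => exact ⟨0, by simp⟩
    | succ m ih =>
      obtain ⟨h, hh⟩ := ih
      refine ⟨g ^ m * w + h * g + l • (h * w), ?_⟩
      rw [pow_succ, hh, pow_succ]
      simp only [mul_add, add_mul, smul_add, smul_mul_assoc, mul_smul_comm]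
      abel
  obtain ⟨h, hh⟩ := hdvd n
  rw [pow_mul, hh, hg, zero_add, smul_pow, hl, zero_smul]

theorem add_sum_smul_pow_eq_zero {Z E ι : Type*} [CommRing Z] [Ring E] [Algebra Z E] {g : E}
    {n p : ℕ} (hg : g ^ n = 0) (s : Finset ι) {l : ι → Z} (hl : ∀ j, l j ^ p = 0) (w : ι → E) :
    (g + ∑ j ∈ s, l j • w j) ^ (n * p ^ s.card) = 0 := by
  classical
  induction s using Finset.induction_on with
  | empty => simpa using hg
  | insert a s ha ih =>
    rw [Finset.sum_insert ha, add_left_comm, add_comm, Finset.card_insert_of_notMem ha, pow_succ,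
      ← mul_assoc]
    exact add_smul_pow_mul_eq_zero ih (hl a) _

/-- Adjoining to an algebra `n` central elements of square zero whose product is faithful. -/
theorem exists_central_sq_zero_extension.{u} (F : Type*) (R : Type u) [Field F] [Ring R]
    [Algebra F R] (n : ℕ) : ∃ (E : Type u) (_ : Ring E) (_ : Algebra F E) (f : R →ₐ[F] E)
      (t : Fin n → Subalgebra.center F E), (∀ i, t i ^ 2 = 0) ∧
        ∀ r, (∏ i, t i) • f r = 0 → r = 0 := by
  induction n with
  | zero => exact ⟨R, inferInstance, inferInstance, AlgHom.id F R, Fin.elim0, by simp, by simp⟩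
  | succ n ih =>
    obtain ⟨E, _, _, f, t, ht, hf⟩ := ih
    have hcent (z : Subalgebra.center F E) :
        (TrivSqZeroExt.inl (z : E) : DualNumber E) ∈ Subalgebra.center F (DualNumber E) := by
      refine Subalgebra.mem_center_iff.2 fun x => ?_
      have := fun y => Subalgebra.mem_center_iff.1 z.2 y
      ext <;> simp [this]
    have heps : (DualNumber.eps : DualNumber E) ∈ Subalgebra.center F (DualNumber E) :=
      Subalgebra.mem_center_iff.2 fun x => DualNumber.commute_eps_right x
    let j : Subalgebra.center F E →+* Subalgebra.center F (DualNumber E) :=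
      { toFun z := ⟨_, hcent z⟩
        map_one' := rfl
        map_zero' := rfl
        map_add' a b := Subtype.ext (TrivSqZeroExt.inl_add _ _ _)
        map_mul' a b := Subtype.ext (TrivSqZeroExt.inl_mul _ _ _) }
    have hj (z) : (j z : DualNumber E) = TrivSqZeroExt.inl (z : E) := rfl
    refine ⟨DualNumber E, inferInstance, inferInstance, (TrivSqZeroExt.inlAlgHom F E E).comp f,
      Fin.cons ⟨_, heps⟩ fun i => j (t i), fun i => ?_, fun r hr => hf r ?_⟩
    · refine Fin.cases ?_ (fun i => ?_) i
      · apply Subtype.ext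
        simp [pow_two]
      · rw [Fin.cons_succ, ← map_pow, ht, map_zero]
    · rw [Fin.prod_univ_succ, Fin.cons_zero] at hr
      simp only [Fin.cons_succ, ← map_prod] at hr
      have := congrArg TrivSqZeroExt.snd hr
      simpa [hj, Subalgebra.smul_def, -map_prod] using this

/-- Coordinates modulo a subspace of finite codimension. -/
theorem Submodule.exists_sub_sum_smul_mem {F V : Type*} [Field F] [AddCommGroup V] [Module F V]
    (I : Submodule F V) [FiniteDimensional F (V ⧸ I)] :
    ∃ (n : ℕ) (e : Fin n → V), ∀ v, ∃ c : Fin n → F, v - ∑ j, c j • e j ∈ I := by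
  obtain ⟨n, s, hs⟩ := Module.Finite.exists_fin (R := F) (M := V ⧸ I)
  choose e he using fun j => I.mkQ_surjective (s j)
  refine ⟨n, e, fun v => ?_⟩
  have hv : I.mkQ v ∈ Submodule.span F (Set.range s) := hs ▸ Submodule.mem_top
  obtain ⟨c, hc⟩ := (Submodule.mem_span_range_iff_exists_fun F).1 hv
  refine ⟨c, (Submodule.Quotient.mk_eq_zero I).1 ?_⟩
  change I.mkQ _ = 0
  simp_rw [map_sub, map_sum, map_smul, he, hc, sub_self]

/-- Over a field of characteristic `p`, the symmetric identity holds in `R` as soon as the elements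
of `S` are, modulo a fixed finite-dimensional space, sums of elements of `M` and `N`. -/
theorem exists_isSymId_of_sub_sum_smul_mem {F R : Type*} [Field F] [Ring R] [Algebra F R]
    {p : ℕ} [Fact p.Prime] [CharP F p] {S M N K : Set R} {k d d₁ d₂ n : ℕ}
    (hk : 0 < k) (hMM : ∀ m ∈ M, ∀ n ∈ M, m * n ∈ M) (hNN : ∀ m ∈ N, ∀ n ∈ N, m * n ∈ N)
    (hM : IsSymId M d₁) (hN : IsSymId N d₂) (hK : IsSymId K d)
    (h : ∀ v w : Fin k → R, (∀ j, v j ∈ M) → (∀ j, w j ∈ N) →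
      (List.ofFn fun j => v j * w j).prod ∈ K)
    (e : Fin n → R)
    (hS : ∀ s ∈ S, ∃ b ∈ M, ∃ c ∈ N, ∃ φ : Fin n → F, s = b + c + ∑ j, φ j • e j) :
    ∃ D : ℕ, 1 ≤ D ∧ IsSymId S D := by
  classical
  have hp : 0 < p := (Fact.out : p.Prime).pos
  refine ⟨(d₂ + k * d * (d₁ + d₂) + d₁ + 1) * p ^ n, Nat.mul_pos (by lia) (by positivity), ?_⟩
  set D := (d₂ + k * d * (d₁ + d₂) + d₁ + 1) * p ^ n with hD
  intro a ha
  choose b hb c hc φ hφ using fun i => hS (a i) (ha i)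
  obtain ⟨E, _, _, f, t, ht, hf⟩ := exists_central_sq_zero_extension F R D
  have hg := add_pow_eq_zero_of_mem_sqZeroSpan f hk hMM hNN hM hN hK h
    (sum_mem (t := Finset.univ) fun i _ => smul_mem_sqZeroSpan f (ht i) (hb i))
    (sum_mem (t := Finset.univ) fun i _ => smul_mem_sqZeroSpan f (ht i) (hc i))
  have hl (j : Fin n) : (∑ i, φ i j • t i) ^ p = 0 := by
    rcases subsingleton_or_nontrivial (Subalgebra.center F E) with _ | _
    · exact Subsingleton.elim _ _
    have : CharP (Subalgebra.center F E) p :=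
      charP_of_injective_algebraMap (algebraMap F _).injective p
    rw [sum_pow_char p]
    refine Finset.sum_eq_zero fun i _ => ?_
    rw [smul_pow, pow_eq_zero_of_le (Fact.out : p.Prime).two_le (ht i), smul_zero]
  have hpow := add_sum_smul_pow_eq_zero hg Finset.univ hl fun j => f (e j)
  have hsum : ∑ i, t i • f (b i) + ∑ i, t i • f (c i) + ∑ j, (∑ i, φ i j • t i) • f (e j) =
      ∑ i, t i • f (a i) := by
    simp_rw [hφ, map_add, map_sum, smul_add, Finset.sum_add_distrib, Finset.smul_sum,
      Finset.sum_smul]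
    rw [Finset.sum_comm]
    simp_rw [map_smul, smul_assoc, smul_comm (t _) (φ _ _)]
  rw [hsum, Finset.card_fin, ← hD, sum_smul_pow_of_sq_eq_zero D t ht] at hpow
  have huniv (s : Set.powersetCard (Fin D) D) : s.1 = Finset.univ :=
    (Finset.card_eq_iff_eq_univ _).1 (s.2.trans (Fintype.card_fin D).symm)
  have hid (s : Set.powersetCard (Fin D) D) : ⇑(s.1.orderEmbOfFin s.2) = id :=
    (Finset.orderEmbOfFin_unique s.2 (f := id) (fun x => by simp [huniv s]) strictMono_id).symm
  let s₀ : Set.powersetCard (Fin D) D := ⟨Finset.univ, Finset.card_fin D⟩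
  rw [Fintype.sum_eq_single s₀ fun s hs => (hs (Subtype.ext (huniv s))).elim] at hpow
  simp only [hid, id] at hpow
  apply hf
  rw [← hpow, map_sum]
  congr 1
  refine Finset.sum_congr rfl fun σ _ => ?_
  rw [map_list_prod, List.map_ofFn]
  rfl

/-- Corollary 2 of the paper.  A two-sided ideal of the `F`-algebra `A₁` is
modelled as an `F`-submodule `I₁` of `A₁` that is closed under left and right multiplication
by arbitrary elements of `A₁`. -/
theorem sum_of_PI_algebras_isPI_of_almost_prod_subset
    (F A : Type*) [Field F] [Infinite F] (p : ℕ) [CharP F p] (hp : 0 < p)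
    [NonUnitalRing A] [Module F A] [SMulCommClass F A A] [IsScalarTower F A A]
    (A₁ A₂ : NonUnitalSubalgebra F A)
    (hsum : ∀ a : A, ∃ a₁ ∈ A₁, ∃ a₂ ∈ A₂, a = a₁ + a₂)
    (d₁ d₂ : ℕ)
    (h₁ : SatisfiesSymIdOn F (A₁ : Set A) d₁)
    (h₂ : SatisfiesSymIdOn F (A₂ : Set A) d₂)
    (k : ℕ) (hk : 0 < k) (i : Fin 2)
    (I₁ : Submodule F A₁) (I₂ : Submodule F A₂)
    (hI₁ : ∀ a x : A₁, x ∈ I₁ → a * x ∈ I₁ ∧ x * a ∈ I₁)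
    (hI₂ : ∀ a x : A₂, x ∈ I₂ → a * x ∈ I₂ ∧ x * a ∈ I₂)
    [FiniteDimensional F (A₁ ⧸ I₁)] [FiniteDimensional F (A₂ ⧸ I₂)]
    (hprod : ∀ v : Fin k → A₁, ∀ w : Fin k → A₂,
      (∀ j, v j ∈ I₁) → (∀ j, w j ∈ I₂) →
      ∃ x ∈ (if i = 0 then A₁ else A₂),
        (List.ofFn fun j => (Unitization.inr (v j : A) * Unitization.inr (w j : A) :
            Unitization F A)).prod = Unitization.inr x) :
    ∃ D : ℕ, 1 ≤ D ∧ SatisfiesSymId F A D := by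
  classical
  have : Fact p.Prime := ⟨(CharP.char_is_prime_or_zero F p).resolve_right hp.ne'⟩
  let ι : A → Unitization F A := Unitization.inr
  have hsub {B : Set A} {d : ℕ} (hB : SatisfiesSymIdOn F B d) : IsSymId (ι '' B) d := by
    intro b hb
    choose a ha hab using hb
    simp_rw [← hab]
    exact hB a ha
  have hmono {M N : Set (Unitization F A)} {d : ℕ} (hMN : M ⊆ N) (hN : IsSymId N d) :
      IsSymId M d := fun b hb => hN b fun i => hMN (hb i)
  obtain ⟨n₁, e₁, he₁⟩ := I₁.exists_sub_sum_smul_mem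
  obtain ⟨n₂, e₂, he₂⟩ := I₂.exists_sub_sum_smul_mem
  let M : Set (Unitization F A) := (fun x : A₁ => ι x) '' I₁
  let N : Set (Unitization F A) := (fun x : A₂ => ι x) '' I₂
  obtain ⟨K, d, hK, hMNK⟩ : ∃ (K : Set (Unitization F A)) (d : ℕ), IsSymId K d ∧
      ∀ v w : Fin k → Unitization F A, (∀ j, v j ∈ M) → (∀ j, w j ∈ N) →
        (List.ofFn fun j => v j * w j).prod ∈ K := by
    have hprod' (v w : Fin k → Unitization F A) (hv : ∀ j, v j ∈ M) (hw : ∀ j, w j ∈ N) :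
        (List.ofFn fun j => v j * w j).prod ∈
          ι '' ((if i = 0 then A₁ else A₂ : NonUnitalSubalgebra F A) : Set A) := by
      choose v' hv' hvv using hv
      choose w' hw' hww using hw
      obtain ⟨x, hx, hxe⟩ := hprod v' w' hv' hw'
      simp_rw [← hvv, ← hww]
      exact ⟨x, hx, hxe.symm⟩
    by_cases hi : i = 0
    · exact ⟨_, d₁, hsub h₁, by simpa only [hi, if_true] using hprod'⟩
    · exact ⟨_, d₂, hsub h₂, by simpa only [hi, if_false] using hprod'⟩
  have hMA : M ⊆ ι '' (A₁ : Set A) := by rintro _ ⟨x, -, rfl⟩; exact ⟨x, x.2, rfl⟩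
  have hNA : N ⊆ ι '' (A₂ : Set A) := by rintro _ ⟨x, -, rfl⟩; exact ⟨x, x.2, rfl⟩
  have hMM : ∀ m ∈ M, ∀ n ∈ M, m * n ∈ M := by
    rintro _ ⟨x, -, rfl⟩ _ ⟨y, hy, rfl⟩
    exact ⟨x * y, (hI₁ x y hy).1, Unitization.inr_mul F _ _⟩
  have hNN : ∀ m ∈ N, ∀ n ∈ N, m * n ∈ N := by
    rintro _ ⟨x, -, rfl⟩ _ ⟨y, hy, rfl⟩
    exact ⟨x * y, (hI₂ x y hy).1, Unitization.inr_mul F _ _⟩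
  obtain ⟨D, hD, hsym⟩ := exists_isSymId_of_sub_sum_smul_mem (F := F) (p := p)
    (S := Set.range ι) hk hMM hNN (hmono hMA (hsub h₁)) (hmono hNA (hsub h₂)) hK hMNK
    (Fin.append (fun j => ι (e₁ j)) (fun j => ι (e₂ j))) (by
      rintro _ ⟨a, rfl⟩
      obtain ⟨a₁, ha₁, a₂, ha₂, rfl⟩ := hsum a
      obtain ⟨c₁, hc₁⟩ := he₁ ⟨a₁, ha₁⟩
      obtain ⟨c₂, hc₂⟩ := he₂ ⟨a₂, ha₂⟩
      refine ⟨_, ⟨_, hc₁, rfl⟩, _, ⟨_, hc₂, rfl⟩, Fin.append c₁ c₂, ?_⟩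
      have hι (x : A) : ι x = Unitization.inrHom F F A x := rfl
      simp only [Fin.sum_univ_add, Fin.append_left, Fin.append_right, hι, ← map_smul, ← map_sum,
        ← map_add]
      congr 1
      push_cast
      abel)
  exact ⟨D, hD, fun a => hsym (fun i => ι (a i)) fun i => ⟨a i, rfl⟩⟩
end

section
/- Let A be an associative algebra (not necessarily with unity) over a field F, let A₁ be a subalgebra of A satisfying the symmetric identity of degree d, let r ≥ 1, and let b₁,…,b_r ∈ A₁. Fix m ≥ 1 and nonnegative integers β₁,…,β_m with β₁ + ⋯ + β_m = r such that β_j ≥ d for some j, and fix elements u₀, u₁, …, u_m of the unitization A¹ of A. Then Σ_{σ ∈ S_r} u₀ · b_σ(1) · u₁ · b_σ(2) · u₂ ⋯ b_σ(m) · u_m = 0, where b_σ(i) denotes the product b_{σ(β₁+⋯+β_{i−1}+1)}⋯b_{σ(β₁+⋯+β_i)} (the empty product, i.e. 1 ∈ A¹, if β_i = 0). -/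
/-- A sum over a finite group vanishes if it vanishes on every left coset of the image of an
injective homomorphism. -/
theorem sum_eq_zero_of_sum_leftCoset_eq_zero {G H M : Type*} [Group G] [Fintype G] [Group H]
    [Fintype H] [AddCommMonoid M] (φ : H →* G) (hφ : Function.Injective φ) (f : G → M)
    (hf : ∀ g, ∑ h, f (g * φ h) = 0) : ∑ g, f g = 0 := by
  classical
  rw [← Finset.sum_fiberwise Finset.univ (fun g : G => (g : G ⧸ φ.range))]
  refine Finset.sum_eq_zero fun q _ => ?_
  rw [← hf q.out]
  symm
  refine Finset.sum_bij (fun h _ => q.out * φ h) ?_ ?_ ?_ ?_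
  · intro h _
    simp [QuotientGroup.mk_mul_of_mem q.out (show φ h ∈ φ.range from ⟨h, rfl⟩)]
  · intro h _ h' _ e
    exact hφ (mul_left_cancel e)
  · intro g hg
    have hg' : (q.out : G ⧸ φ.range) = g := by simpa using (Finset.mem_filter.mp hg).2.symm
    obtain ⟨h, hh⟩ := QuotientGroup.eq.mp hg'
    exact ⟨h, Finset.mem_univ _, by rw [hh, mul_inv_cancel_left]⟩
  · intro h _
    rfl

/-- If the family `c` differs from `c₀` at most at `j`, then `(List.ofFn c).prod` is `c j` multiplied
by the products of the entries of `c₀` before and after `j`. -/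
theorem List.prod_ofFn_eq_of_eq_off {M : Type*} [Monoid M] {m : ℕ} (c c₀ : Fin m → M) (j : Fin m)
    (hc : ∀ i, i ≠ j → c i = c₀ i) :
    (List.ofFn c).prod =
      ((List.ofFn c₀).take j).prod * c j * ((List.ofFn c₀).drop (j + 1)).prod := by
  have key : List.ofFn c = (List.ofFn c₀).set j (c j) := by
    refine List.ext_getElem (by simp) fun i h₁ h₂ => ?_
    rw [List.getElem_set]
    split_ifs with hij
    · subst hij
      simp
    · simpa using hc ⟨i, by simpa using h₁⟩ fun e => hij (by simp [← e])
  rw [key, List.prod_set]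
  simp

theorem List.take_drop_ofFn_congr {X : Type*} {r : ℕ} (f g : Fin r → X) (s n : ℕ)
    (h : ∀ i : Fin r, s ≤ i → i < s + n → f i = g i) :
    ((List.ofFn f).drop s).take n = ((List.ofFn g).drop s).take n := by
  refine List.ext_getElem (by simp) fun i h₁ h₂ => ?_
  simp only [List.length_take, List.length_drop, List.length_ofFn, lt_min_iff] at h₁
  simpa using h ⟨s + i, by omega⟩ (by simp) (by simpa using h₁.1)

theorem List.take_drop_ofFn {X : Type*} {r : ℕ} (f : Fin r → X) (s n : ℕ) (h : s + n ≤ r) :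
    ((List.ofFn f).drop s).take n = List.ofFn fun k : Fin n => f ⟨s + k, by omega⟩ := by
  refine List.ext_getElem (by simp; omega) fun i h₁ h₂ => ?_
  simp

theorem Fin.sum_Iio_add_le_of_lt {m : ℕ} (β : Fin m → ℕ) {i j : Fin m} (h : i < j) :
    ∑ k ∈ Finset.Iio i, β k + β i ≤ ∑ k ∈ Finset.Iio j, β k := by
  rw [add_comm, ← Finset.sum_insert (by simp)]
  refine Finset.sum_le_sum_of_subset fun k hk => ?_
  simp only [Finset.mem_insert, Finset.mem_Iio] at hk ⊢
  rcases hk with rfl | hk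
  exacts [h, hk.trans h]

theorem Fin.sum_Iio_add_le_sum {m : ℕ} (β : Fin m → ℕ) (j : Fin m) :
    ∑ k ∈ Finset.Iio j, β k + β j ≤ ∑ k, β k := by
  rw [add_comm, ← Finset.sum_insert (by simp)]
  exact Finset.sum_le_sum_of_subset (Finset.subset_univ _)


/-- if the subalgebra `A₁` satisfies the symmetric identity of degree `d`,
`b₁, …, b_r ∈ A₁`, `β₁ + ⋯ + β_m = r` with `β_j ≥ d` for some `j`, and
`u₀, u₁, …, u_m` are arbitrary elements of the unitization `A¹ = Unitization F A`, then
`∑_{σ ∈ S_r} u₀ ⬝ b_σ(1) ⬝ u₁ ⬝ b_σ(2) ⬝ u₂ ⋯ b_σ(m) ⬝ u_m = 0`, where `b_σ(i)` is the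
product of the `β_i` consecutive factors `b_{σ(β₁+⋯+β_{i-1}+1)} ⋯ b_{σ(β₁+⋯+β_i)}`
(the empty product `1 ∈ A¹` if `β_i = 0`). -/
theorem symSum_blocks_eq_zero_of_big_block
    (F A : Type*) [Field F] [NonUnitalRing A]
    [Module F A] [SMulCommClass F A A] [IsScalarTower F A A]
    (A₁ : NonUnitalSubalgebra F A) (d : ℕ)
    (h₁ : SatisfiesSymIdOn F (A₁ : Set A) d)
    (r : ℕ) (hr : 1 ≤ r) (b : Fin r → A) (hb : ∀ i, b i ∈ A₁)
    (m : ℕ) (hm : 1 ≤ m) (β : Fin m → ℕ) (hβ : ∑ i, β i = r)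
    (j₀ : Fin m) (hd : d ≤ β j₀)
    (u : Fin (m + 1) → Unitization F A) :
    ∑ σ : Equiv.Perm (Fin r),
      u 0 * (List.ofFn fun j : Fin m =>
        ((((List.ofFn fun i => (Unitization.inr (b (σ i)) : Unitization F A)).drop
            (∑ i ∈ Finset.Iio j, β i)).take (β j)).prod) * u j.succ).prod = 0 := by

  classical
  set s := ∑ i ∈ Finset.Iio j₀, β i with hs
  have hsr : s + β j₀ ≤ r := hβ ▸ Fin.sum_Iio_add_le_sum β j₀
  let ι : Fin d ↪ Fin r :=
    ⟨fun k => ⟨s + k, by omega⟩, fun k l h => Fin.ext (by simpa using h)⟩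
  refine sum_eq_zero_of_sum_leftCoset_eq_zero (Equiv.Perm.viaEmbeddingHom ι)
    (Equiv.Perm.viaEmbeddingHom_injective ι) _ fun σ => ?_
  let l : Equiv.Perm (Fin r) → List (Unitization F A) := fun ρ =>
    List.ofFn fun i => Unitization.inr (b (ρ i))
  let c : Equiv.Perm (Fin r) → Fin m → Unitization F A := fun ρ j =>
    (((l ρ).drop (∑ i ∈ Finset.Iio j, β i)).take (β j)).prod * u j.succ
  have fixed (τ : Equiv.Perm (Fin d)) (i : Fin r) (hi : (i : ℕ) < s ∨ s + d ≤ i) :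
      (σ * Equiv.Perm.viaEmbeddingHom ι τ) i = σ i := by
    rw [Equiv.Perm.mul_apply, Equiv.Perm.viaEmbeddingHom_apply,
      Equiv.Perm.viaEmbedding_apply_of_notMem]
    rintro ⟨k, rfl⟩
    have := k.2
    change s + (k : ℕ) < s ∨ s + d ≤ s + (k : ℕ) at hi
    omega
  have congr_block (τ : Equiv.Perm (Fin d)) (p n : ℕ) (h : p + n ≤ s ∨ s + d ≤ p) :
      ((l (σ * Equiv.Perm.viaEmbeddingHom ι τ)).drop p).take n = ((l σ).drop p).take n := by
    refine List.take_drop_ofFn_congr _ _ p n fun i h₁ h₂ => ?_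
    rw [fixed τ i (by omega)]
  have off (τ : Equiv.Perm (Fin d)) (j : Fin m) (hj : j ≠ j₀) :
      c (σ * Equiv.Perm.viaEmbeddingHom ι τ) j = c σ j := by
    simp only [c]
    rw [congr_block τ]
    rcases lt_or_gt_of_ne hj with h | h
    · exact Or.inl (Fin.sum_Iio_add_le_of_lt β h)
    · exact Or.inr ((Nat.add_le_add_left hd s).trans (Fin.sum_Iio_add_le_of_lt β h))
  have big (τ : Equiv.Perm (Fin d)) :
      c (σ * Equiv.Perm.viaEmbeddingHom ι τ) j₀ =
        permProd F (fun k => b (σ (ι k))) τ *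
          ((((l σ).drop (s + d)).take (β j₀ - d)).prod * u j₀.succ) := by
    have split : β j₀ = d + (β j₀ - d) := by omega
    simp only [c]
    rw [← hs, split, List.take_add, List.drop_drop, congr_block τ _ _ (Or.inr le_rfl),
      List.prod_append, mul_assoc, ← split]
    congr 1
    rw [List.take_drop_ofFn _ s d (by omega), permProd]
    congr 2
    funext k
    change (Unitization.inr (b (σ (Equiv.Perm.viaEmbedding τ ι (ι k)))) : Unitization F A) = _
    rw [Equiv.Perm.viaEmbedding_apply]
  have sym : ∑ τ, permProd F (fun k => b (σ (ι k))) τ = 0 :=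
    h₁ _ fun k => hb _
  change ∑ τ, u 0 * (List.ofFn (c (σ * Equiv.Perm.viaEmbeddingHom ι τ))).prod = 0
  simp_rw [fun τ => List.prod_ofFn_eq_of_eq_off _ (c σ) j₀ (off τ), big]
  rw [← Finset.mul_sum, ← Finset.sum_mul, ← Finset.mul_sum, ← Finset.sum_mul, sym]
  simp
end
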